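/- arXiv:2507.04583 — 2 statements merged into one kernel-verified Lean document; each statement's English description precedes it below -/
import Mathlib

section
/- Let S ⊆ ℝ be an open interval and let g : ℝ → ℝ be twice differentiable on S with g'(μ) ≠ 0 for all μ ∈ S. If there are constants d₁, d₂ such that g''(μ)/(g'(μ))³ = d₁ + d₂μ for all μ ∈ S, then there exists a constant d₀ such that for all μ ∈ S: d₀ + 2d₁μ + d₂μ² < 0 and (g'(μ))² = −1/(d₀ + 2d₁μ + d₂μ²). -/
open Real Set

/-- Remark 2 of the paper (converse direction): if `g''(μ)/(g'(μ))³ = d₁ + d₂μ` on an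
open interval `S` with `g'` nonvanishing, then there is a constant `d₀` such that the
quadratic `d₀ + 2d₁μ + d₂μ²` is negative on `S` and `(g'(μ))² = -1/(d₀ + 2d₁μ + d₂μ²)`. -/
theorem converse_linear_ratio
    (S : Set ℝ) (hSopen : IsOpen S) (hSconn : S.OrdConnected)
    (g : ℝ → ℝ) (d₁ d₂ : ℝ)
    (hg : ∀ μ ∈ S, DifferentiableAt ℝ g μ)
    (hg2 : ∀ μ ∈ S, DifferentiableAt ℝ (deriv g) μ)
    (hg' : ∀ μ ∈ S, deriv g μ ≠ 0)
    (hlin : ∀ μ ∈ S, deriv (deriv g) μ / (deriv g μ) ^ 3 = d₁ + d₂ * μ) :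
    ∃ d₀ : ℝ, ∀ μ ∈ S,
      d₀ + 2 * d₁ * μ + d₂ * μ ^ 2 < 0 ∧
      (deriv g μ) ^ 2 = -1 / (d₀ + 2 * d₁ * μ + d₂ * μ ^ 2) := by
  have hF : ∀ μ ∈ S, HasDerivAt
      (fun x => -((deriv g x) ^ 2)⁻¹ - (2 * d₁ * x + d₂ * x ^ 2)) 0 μ := by
    intro μ hμ
    have hne := hg' μ hμ
    have hinv := (((hg2 μ hμ).hasDerivAt.fun_pow 2).fun_inv (pow_ne_zero 2 hne)).fun_neg
    have hquad := ((hasDerivAt_id' μ).const_mul (2 * d₁)).fun_add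
      (((hasDerivAt_id' μ).fun_pow 2).const_mul d₂)
    refine (hinv.fun_sub hquad).congr_deriv ?_
    have hode := hlin μ hμ
    field_simp at hode ⊢
    push_cast
    linear_combination 2 * deriv g μ * hode
  obtain ⟨d₀, hd₀⟩ := hSopen.exists_is_const_of_deriv_eq_zero hSconn.isPreconnected
    (fun μ hμ => (hF μ hμ).differentiableAt.differentiableWithinAt)
    (fun μ hμ => (hF μ hμ).deriv)
  refine ⟨d₀, fun μ hμ => ?_⟩
  have hpos : 0 < (deriv g μ) ^ 2 := by have := hg' μ hμ; positivity
  have hquad : d₀ + 2 * d₁ * μ + d₂ * μ ^ 2 = -((deriv g μ) ^ 2)⁻¹ := by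
    linear_combination -hd₀ μ hμ
  rw [hquad]
  exact ⟨neg_neg_of_pos (inv_pos.mpr hpos), by field_simp⟩
end

section
/- Let g : ℝ → ℝ be twice differentiable on all of ℝ with g'(μ) ≠ 0 for every μ ∈ ℝ, and suppose g''(μ)/(g'(μ))³ = d₁ + d₂μ for all μ ∈ ℝ. Then there exists d₀ with d₀ + 2d₁μ + d₂μ² < 0 for all μ ∈ ℝ, and consequently: if d₂ = 0 and d₁ = 0 then d₀ < 0; if d₂ = 0 then necessarily d₁ = 0; and if d₂ ≠ 0 then d₂ < 0 and d₁² < d₀d₂. -/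
open Real Set

/-- If `f' / f ^ 3 = a + b x` with `f` nowhere zero, then
`(f x ^ 2)⁻¹ + 2 a x + b x ^ 2` is constant. -/
theorem inv_sq_add_quadratic_eq_of_deriv_div_cube (f : ℝ → ℝ) (a b : ℝ)
    (hf : ∀ x, DifferentiableAt ℝ f x) (h0 : ∀ x, f x ≠ 0)
    (h : ∀ x, deriv f x / f x ^ 3 = a + b * x) (x : ℝ) :
    (f x ^ 2)⁻¹ + 2 * a * x + b * x ^ 2 = (f 0 ^ 2)⁻¹ := by
  have hd : ∀ y, HasDerivAt (fun y => (f y ^ 2)⁻¹ + 2 * a * y + b * y ^ 2) 0 y := by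
    intro y
    have h1 := (((hf y).hasDerivAt.fun_pow 2).fun_inv (pow_ne_zero 2 (h0 y))).fun_add
      ((hasDerivAt_id' y).const_mul (2 * a))
    refine (h1.fun_add ((hasDerivAt_pow 2 y).const_mul b)).congr_deriv ?_
    have hy := h0 y
    have h2 := h y
    rw [div_eq_iff (pow_ne_zero 3 hy)] at h2
    rw [h2]
    field_simp
    push_cast
    ring
  have hc := is_const_of_deriv_eq_zero (fun y => (hd y).differentiableAt)
    (fun y => (hd y).deriv) x 0
  simpa using hc

/-- A real quadratic polynomial that is negative everywhere and has vanishing leading coefficient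
has vanishing linear coefficient. -/
theorem linear_coeff_eq_zero_of_forall_neg {c a : ℝ} (h : ∀ x : ℝ, c + 2 * a * x < 0) :
    a = 0 := by
  by_contra ha
  have h1 := h (-c / (2 * a))
  rw [mul_div_cancel₀ _ (mul_ne_zero two_ne_zero ha)] at h1
  linarith

/-- A real quadratic polynomial that is negative everywhere with nonzero leading coefficient
has negative leading coefficient and negative discriminant. -/
theorem leading_coeff_neg_of_forall_quadratic_neg {c a b : ℝ} (hb : b ≠ 0)
    (h : ∀ x : ℝ, c + 2 * a * x + b * x ^ 2 < 0) : b < 0 ∧ a ^ 2 < c * b := by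
  have hneg : b < 0 := by
    by_contra! hle
    have hpos : 0 < b := lt_of_le_of_ne hle hb.symm
    have h1 := h (1 - c / b)
    have h2 := h (-(1 - c / b))
    have hc : c = b * (c / b) := by field_simp
    have h3 : 0 < b * (c / b + (1 - c / b) ^ 2) :=
      mul_pos hpos (by nlinarith [sq_nonneg (c / b - 1 / 2)])
    nlinarith
  refine ⟨hneg, ?_⟩
  have h1 := mul_pos_of_neg_of_neg (h (-a / b)) hneg
  have h2 : (c + 2 * a * (-a / b) + b * (-a / b) ^ 2) * b = c * b - a ^ 2 := by
    field_simp
    ring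
  linarith

/-- Continuation of Remark 2 of the paper: if `g''(μ)/(g'(μ))³ = d₁ + d₂μ` for all real
`μ` with `g'` nonvanishing everywhere, then there is `d₀` with
`d₀ + 2d₁μ + d₂μ² < 0` for all `μ`, and consequently: if `d₂ = 0` and `d₁ = 0` then
`d₀ < 0`; if `d₂ = 0` then `d₁ = 0`; and if `d₂ ≠ 0` then `d₂ < 0` and `d₁² < d₀d₂`. -/
theorem converse_linear_ratio_global
    (g : ℝ → ℝ) (d₁ d₂ : ℝ)
    (hg : ∀ μ : ℝ, DifferentiableAt ℝ g μ)
    (hg2 : ∀ μ : ℝ, DifferentiableAt ℝ (deriv g) μ)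
    (hg' : ∀ μ : ℝ, deriv g μ ≠ 0)
    (hlin : ∀ μ : ℝ, deriv (deriv g) μ / (deriv g μ) ^ 3 = d₁ + d₂ * μ) :
    ∃ d₀ : ℝ,
      (∀ μ : ℝ, d₀ + 2 * d₁ * μ + d₂ * μ ^ 2 < 0) ∧
      ((d₂ = 0 ∧ d₁ = 0) → d₀ < 0) ∧
      (d₂ = 0 → d₁ = 0) ∧
      (d₂ ≠ 0 → d₂ < 0 ∧ d₁ ^ 2 < d₀ * d₂) := by
  have hneg : ∀ μ : ℝ, -((deriv g 0) ^ 2)⁻¹ + 2 * d₁ * μ + d₂ * μ ^ 2 < 0 := by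
    intro μ
    have h1 := inv_sq_add_quadratic_eq_of_deriv_div_cube (deriv g) d₁ d₂ hg2 hg' hlin μ
    have h2 : 0 < ((deriv g μ) ^ 2)⁻¹ := inv_pos.mpr (sq_pos_iff.mpr (hg' μ))
    linarith
  refine ⟨_, hneg, fun _ => by simpa using hneg 0, fun h => ?_,
    fun h => leading_coeff_neg_of_forall_quadratic_neg h hneg⟩
  subst h
  simp only [zero_mul, add_zero] at hneg
  exact linear_coeff_eq_zero_of_forall_neg hneg
end
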